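/- Let C be a category with an orthogonal factorization system (L,R). Define, for the category C^⨿: a morphism (φ,(fᵢ)) lies in L^⨿ if φ is inert in ℱ* and each fᵢ lies in L, and lies in R^⨿ if φ is active in ℱ* and each fᵢ lies in R. Then (L^⨿, R^⨿) is an orthogonal factorization system on C^⨿. -/

import Mathlib

open CategoryTheory Limits

universe w v u v' u' v'' u''

/-- Objects of the skeleton `ℱ*` of finite pointed sets: `⟨n⟩ = ({0,1,…,n},0)`. -/
structure FinPtd where
  n : ℕ

namespace FinPtd

/-- Morphisms of `ℱ*` are basepoint-preserving maps. -/
instance : Category FinPtd where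
  Hom a b := {f : Fin (a.n + 1) → Fin (b.n + 1) // f 0 = 0}
  id a := ⟨id, rfl⟩
  comp f g := ⟨g.1 ∘ f.1, by simp [Function.comp, f.2, g.2]⟩
  id_comp f := rfl
  comp_id f := rfl
  assoc f g h := rfl

/-- A morphism `φ : ⟨n⟩ → ⟨m⟩` is inert if every `j ∈ {1,…,m}` has exactly one preimage. -/
def Inert {a b : FinPtd} (φ : a ⟶ b) : Prop :=
  ∀ j : Fin (b.n + 1), j ≠ 0 → ∃! i : Fin (a.n + 1), φ.1 i = j

/-- A morphism `φ : ⟨n⟩ → ⟨m⟩` is active if `φ⁻¹(0) = {0}`. -/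
def Active {a b : FinPtd} (φ : a ⟶ b) : Prop :=
  ∀ i : Fin (a.n + 1), φ.1 i = 0 → i = 0

/-- The inert morphism `ρᵢ : ⟨n⟩ → ⟨1⟩` (for `1 ≤ i ≤ n`) sending `i` to `1` and everything
else to the basepoint. -/
def rho (n i : ℕ) : FinPtd.mk n ⟶ FinPtd.mk 1 :=
  ⟨fun j => if j.1 = i ∧ 1 ≤ i then 1 else 0, by
    have h : ¬((0 : Fin (n + 1)).1 = i ∧ 1 ≤ i) := by
      simp only [Fin.val_zero]
      omega
    exact if_neg h⟩

/-- The class of inert morphisms of `ℱ*`. -/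
def inertProp : MorphismProperty FinPtd := fun _ _ f => Inert f

/-- The class of active morphisms of `ℱ*`. -/
def activeProp : MorphismProperty FinPtd := fun _ _ f => Active f

end FinPtd

/-- An orthogonal factorization system `(L, R)` on a category: both classes contain all
isomorphisms, are closed under composition, every morphism factors as a morphism in `L`
followed by a morphism in `R`, and `L` is left orthogonal to `R` with unique diagonal
fillers (which makes the factorization unique up to unique compatible isomorphism). -/
structure IsOFS {C : Type u} [Category.{v} C] (L R : MorphismProperty C) : Prop where
  iso_left : ∀ {X Y : C} (f : X ⟶ Y), IsIso f → L f
  iso_right : ∀ {X Y : C} (f : X ⟶ Y), IsIso f → R f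
  comp_left : ∀ {X Y Z : C} (f : X ⟶ Y) (g : Y ⟶ Z), L f → L g → L (f ≫ g)
  comp_right : ∀ {X Y Z : C} (f : X ⟶ Y) (g : Y ⟶ Z), R f → R g → R (f ≫ g)
  factor : ∀ {X Y : C} (f : X ⟶ Y), ∃ (Z : C) (l : X ⟶ Z) (r : Z ⟶ Y), L l ∧ R r ∧ l ≫ r = f
  lift_unique : ∀ {A B X Y : C} (l : A ⟶ B) (r : X ⟶ Y) (u : A ⟶ X) (v : B ⟶ Y),
      L l → R r → l ≫ v = u ≫ r → ∃! d : B ⟶ X, l ≫ d = u ∧ d ≫ r = v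
section Fam

variable {C : Type u} [Category.{v} C]

/-- Hom-sets for the category `C` with a freely added zero object: used to encode the
components of morphisms in `C^⨿`. -/
def OHom : Option C → Option C → Type v
  | some a, some b => (a ⟶ b)
  | some _, none => PUnit
  | none, none => PUnit
  | none, some _ => PEmpty

/-- Identities for `OHom`. -/
def OId : ∀ x : Option C, OHom x x
  | some a => 𝟙 a
  | none => PUnit.unit

/-- Composition for `OHom`. -/
def OComp : ∀ {x y z : Option C}, OHom x y → OHom y z → OHom x z
  | some _, some _, some _, f, g => f ≫ g
  | some _, some _, none, _, _ => PUnit.unit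
  | some _, none, none, _, _ => PUnit.unit
  | none, none, none, _, _ => PUnit.unit
  | some _, none, some _, _, g => g.elim
  | none, some _, _, f, _ => f.elim
  | none, none, some _, _, g => g.elim

theorem OId_comp : ∀ {x y : Option C} (f : OHom x y), OComp (OId x) f = f
  | some _, some _, f => Category.id_comp f
  | some _, none, _ => rfl
  | none, none, _ => rfl
  | none, some _, f => f.elim

theorem OComp_id : ∀ {x y : Option C} (f : OHom x y), OComp f (OId y) = f
  | some _, some _, f => Category.comp_id f
  | some _, none, _ => rfl
  | none, none, _ => rfl
  | none, some _, f => f.elim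

theorem OComp_assoc : ∀ {w x y z : Option C} (f : OHom w x) (g : OHom x y) (h : OHom y z),
    OComp (OComp f g) h = OComp f (OComp g h)
  | some _, some _, some _, some _, f, g, h => Category.assoc f g h
  | some _, some _, some _, none, _, _, _ => rfl
  | some _, some _, none, none, _, _, _ => rfl
  | some _, none, none, none, _, _, _ => rfl
  | none, none, none, none, _, _, _ => rfl
  | none, some _, _, _, f, _, _ => f.elim
  | some _, none, some _, _, _, g, _ => g.elim
  | none, none, some _, _, _, g, _ => g.elim
  | some _, some _, none, some _, _, _, h => h.elim
  | some _, none, none, some _, _, _, h => h.elim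
  | none, none, none, some _, _, _, h => h.elim

/-- A property of morphisms of `C`, extended to `OHom` (trivially true on the degenerate
components). -/
def OProp (W : MorphismProperty C) : ∀ {x y : Option C}, OHom x y → Prop
  | some _, some _, f => W f
  | some _, none, _ => True
  | none, none, _ => True
  | none, some _, _ => True

/-- Objects of `C^⨿`: tuples `⟨n⟩(c₁,…,cₙ)`, encoded as a length `n` together with a
family indexed by `⟨n⟩ = {0,1,…,n}` which is `none` exactly at the basepoint `0`. -/
structure FamObj (C : Type u) [Category.{v} C] where
  len : ℕ
  obj : Fin (len + 1) → Option C
  obj_zero : obj 0 = none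
  obj_ne : ∀ i : Fin (len + 1), i ≠ 0 → (obj i).isSome

/-- Morphisms of `C^⨿`: a morphism `φ` of `ℱ*` together with components
`cᵢ ⟶ c'_{φ(i)}` for all `i` with `φ(i) ≠ 0`. -/
structure FamHom (A B : FamObj C) where
  φ : FinPtd.mk A.len ⟶ FinPtd.mk B.len
  f : ∀ i : Fin (A.len + 1), OHom (A.obj i) (B.obj (φ.1 i))

theorem FamHom.ext' {A B : FamObj C} {F G : FamHom A B}
    (h1 : F.φ = G.φ) (h2 : ∀ i, HEq (F.f i) (G.f i)) : F = G := by
  obtain ⟨φ, f⟩ := F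
  obtain ⟨φ', f'⟩ := G
  dsimp at h1
  subst h1
  have : f = f' := funext fun i => eq_of_heq (h2 i)
  rw [this]

instance : Category (FamObj C) where
  Hom A B := FamHom A B
  id A := ⟨𝟙 (FinPtd.mk A.len), fun i => OId (A.obj i)⟩
  comp F G := ⟨F.φ ≫ G.φ, fun i => OComp (F.f i) (G.f (F.φ.1 i))⟩
  id_comp _F := FamHom.ext' rfl (fun _i => heq_of_eq (OId_comp _))
  comp_id _F := FamHom.ext' rfl (fun _i => heq_of_eq (OComp_id _))
  assoc _F _G _H := FamHom.ext' rfl (fun _i => heq_of_eq (OComp_assoc _ _ _))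

@[simp] theorem Fam_id_φ (A : FamObj C) : (𝟙 A : FamHom A A).φ = 𝟙 (FinPtd.mk A.len) := rfl

@[simp] theorem Fam_comp_φ {A B D : FamObj C} (F : A ⟶ B) (G : B ⟶ D) :
    (F ≫ G).φ = F.φ ≫ G.φ := rfl

/-- The projection `C^⨿ → ℱ*`. -/
def famProj : FamObj C ⥤ FinPtd where
  obj A := FinPtd.mk A.len
  map F := F.φ
  map_id _ := rfl
  map_comp _ _ := rfl

end Fam

/-- The class `L^⨿` on `C^⨿`: `(φ,(fᵢ))` with `φ` inert in `ℱ*` and all components in `L`. -/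
def famLeft {C : Type u} [Category.{v} C] (L : MorphismProperty C) :
    MorphismProperty (FamObj C) :=
  fun _ _ F => FinPtd.Inert F.φ ∧ ∀ i, OProp L (F.f i)

/-- The class `R^⨿` on `C^⨿`: `(φ,(fᵢ))` with `φ` active in `ℱ*` and all components in `R`. -/
def famRight {C : Type u} [Category.{v} C] (R : MorphismProperty C) :
    MorphismProperty (FamObj C) :=
  fun _ _ F => FinPtd.Active F.φ ∧ ∀ i, OProp R (F.f i)

section FamLemmas

variable {C : Type u} [Category.{v} C]

theorem OHom.eq_of_none : ∀ {x y : Option C} (_ : y = none) (f g : OHom x y), f = g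
  | some _, none, _, PUnit.unit, PUnit.unit => rfl
  | none, none, _, PUnit.unit, PUnit.unit => rfl

theorem OHom.heq_of_none {x y y' : Option C} (hy : y = none) (hy' : y' = none)
    (f : OHom x y) (g : OHom x y') : HEq f g := by
  obtain rfl := hy.trans hy'.symm
  exact heq_of_eq (OHom.eq_of_none hy f g)

theorem OHom.nonempty_of_none : ∀ {x y : Option C} (_ : y = none), Nonempty (OHom x y)
  | some _, none, _ => ⟨PUnit.unit⟩
  | none, none, _ => ⟨PUnit.unit⟩

theorem OProp_of_none (W : MorphismProperty C) :
    ∀ {x y : Option C} (_ : y = none) (f : OHom x y), OProp W f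
  | some _, none, _, _ => trivial
  | none, none, _, _ => trivial

theorem OProp_comp {W : MorphismProperty C}
    (hW : ∀ {X Y Z : C} (f : X ⟶ Y) (g : Y ⟶ Z), W f → W g → W (f ≫ g)) :
    ∀ {x y z : Option C} (f : OHom x y) (g : OHom y z),
      OProp W f → OProp W g → OProp W (OComp f g)
  | some _, some _, some _, f, g, hf, hg => hW f g hf hg
  | _, _, none, _, _, _, _ => OProp_of_none W rfl _
  | some _, none, some _, _, g, _, _ => g.elim
  | none, some _, _, f, _, _, _ => f.elim
  | none, none, some _, _, g, _, _ => g.elim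

theorem OProp_of_inverse {W : MorphismProperty C}
    (hW : ∀ {X Y : C} (f : X ⟶ Y), IsIso f → W f) :
    ∀ {x y : Option C} (f : OHom x y) (g : OHom y x),
      OComp f g = OId x → OComp g f = OId y → OProp W f
  | some _, some _, f, g, h₁, h₂ => hW f ⟨g, h₁, h₂⟩
  | _, none, _, _, _, _ => OProp_of_none W rfl _
  | none, some _, f, _, _, _ => f.elim

theorem IsOFS.exists_option_factor {L R : MorphismProperty C} (h : IsOFS L R) :
    ∀ {x y : Option C} (f : OHom x y), ∃ (z : Option C) (l : OHom x z) (r : OHom z y),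
      OProp L l ∧ OProp R r ∧ OComp l r = f ∧ (z = none ↔ y = none)
  | some _, some _, f => by
    obtain ⟨Z, l, r, hl, hr, e⟩ := h.factor f
    exact ⟨some Z, l, r, hl, hr, e, by simp⟩
  | x, none, f => by
    obtain ⟨l⟩ := OHom.nonempty_of_none (x := x) (y := none) rfl
    exact ⟨none, l, OId none, OProp_of_none L rfl _, OProp_of_none R rfl _,
      OHom.eq_of_none rfl _ _, by simp⟩
  | none, some _, f => f.elim

theorem IsOFS.existsUnique_option_lift {L R : MorphismProperty C} (h : IsOFS L R) :
    ∀ {a b x y : Option C} (l : OHom a b) (r : OHom x y) (u : OHom a x) (v : OHom b y),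
      OProp L l → OProp R r → (y = none → x = none) → OComp l v = OComp u r →
      ∃! d : OHom b x, OComp l d = u ∧ OComp d r = v
  | some _, some _, some _, some _, l, r, u, v, hl, hr, _, e => h.lift_unique l r u v hl hr e
  | _, b, none, none, l, r, u, v, _, _, _, _ => by
    obtain ⟨d⟩ := OHom.nonempty_of_none (x := b) (y := none) rfl
    exact ⟨d, ⟨OHom.eq_of_none rfl _ _, OHom.eq_of_none rfl _ _⟩,
      fun _ _ => OHom.eq_of_none rfl _ _⟩
  | _, _, some _, none, _, _, _, _, _, _, hxy, _ => nomatch hxy rfl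
  | _, _, none, some _, _, r, _, _, _, _, _, _ => r.elim
  | _, none, _, some _, _, _, _, v, _, _, _, _ => v.elim
  | none, some _, _, _, l, _, _, _, _, _, _, _ => l.elim

theorem FamObj.obj_eq_none_iff (A : FamObj C) {i : Fin (A.len + 1)} :
    A.obj i = none ↔ i = 0 := by
  refine ⟨fun h => ?_, fun h => h ▸ A.obj_zero⟩
  by_contra hi
  simpa [h] using A.obj_ne i hi

/-- The component of a morphism at `i`, with codomain rewritten along `φ i = j`. -/
def FamHom.component {A B : FamObj C} (F : FamHom A B) {i : Fin (A.len + 1)}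
    {j : Fin (B.len + 1)} (h : F.φ.1 i = j) : OHom (A.obj i) (B.obj j) :=
  h ▸ F.f i

theorem FamHom.component_congr {A B : FamObj C} {F G : FamHom A B} (e : F = G)
    {i : Fin (A.len + 1)} {j : Fin (B.len + 1)} (h : F.φ.1 i = j) (h' : G.φ.1 i = j) :
    F.component h = G.component h' := by
  subst e
  rfl

theorem FamHom.component_comp {A B D : FamObj C} (F : A ⟶ B) (G : B ⟶ D)
    {i : Fin (A.len + 1)} {j : Fin (B.len + 1)} {k : Fin (D.len + 1)}
    (hF : (FamHom.φ F).1 i = j) (hG : (FamHom.φ G).1 j = k)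
    (h : (FamHom.φ (F ≫ G)).1 i = k) :
    FamHom.component (F ≫ G) h = OComp (FamHom.component F hF) (FamHom.component G hG) := by
  subst hF hG
  rfl

theorem FamHom.ext_component {A B : FamObj C} {F G : FamHom A B}
    (hφ : ∀ i, F.φ.1 i = G.φ.1 i)
    (hf : ∀ i j (h : F.φ.1 i = j) (h' : G.φ.1 i = j), F.component h = G.component h') :
    F = G := by
  obtain ⟨φ, f⟩ := F
  obtain ⟨ψ, g⟩ := G
  obtain rfl : φ = ψ := Subtype.ext (funext hφ)
  exact congrArg _ (funext fun i => hf i _ rfl rfl)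

theorem FamHom.oProp_component {W : MorphismProperty C} {A B : FamObj C} {F : FamHom A B}
    (hF : ∀ i, OProp W (F.f i)) {i : Fin (A.len + 1)} {j : Fin (B.len + 1)}
    (h : F.φ.1 i = j) : OProp W (F.component h) := by
  subst h
  exact hF i

theorem Fam_iso_φ_injective {A B : FamObj C} (F : A ⟶ B) [IsIso F] :
    Function.Injective (FamHom.φ F).1 :=
  Function.LeftInverse.injective (g := (FamHom.φ (inv F)).1) fun i =>
    congrArg (fun G : A ⟶ A => (FamHom.φ G).1 i) (IsIso.hom_inv_id F)

theorem Fam_iso_φ_surjective {A B : FamObj C} (F : A ⟶ B) [IsIso F] :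
    Function.Surjective (FamHom.φ F).1 :=
  Function.RightInverse.surjective (g := (FamHom.φ (inv F)).1) fun i =>
    congrArg (fun G : B ⟶ B => (FamHom.φ G).1 i) (IsIso.inv_hom_id F)

theorem Fam_iso_oProp {W : MorphismProperty C}
    (hW : ∀ {X Y : C} (f : X ⟶ Y), IsIso f → W f) {A B : FamObj C} (F : A ⟶ B) [IsIso F]
    (i : Fin (A.len + 1)) : OProp W (FamHom.f F i) := by
  have hi : (FamHom.φ (inv F)).1 ((FamHom.φ F).1 i) = i :=
    congrArg (fun G : A ⟶ A => (FamHom.φ G).1 i) (IsIso.hom_inv_id F)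
  refine OProp_of_inverse hW (FamHom.f F i) (FamHom.component (inv F) hi) ?_ ?_
  · exact (FamHom.component_comp F (inv F) rfl hi hi).symm.trans
      (FamHom.component_congr (IsIso.hom_inv_id F) hi rfl)
  · have hc : (FamHom.φ (inv F ≫ F)).1 ((FamHom.φ F).1 i) = (FamHom.φ F).1 i :=
      congrArg (FamHom.φ F).1 hi
    exact (FamHom.component_comp (inv F) F hi rfl hc).symm.trans
      (FamHom.component_congr (IsIso.inv_hom_id F) hc rfl)

theorem FinPtd.Inert.comp {a b c : FinPtd} {φ : a ⟶ b} {ψ : b ⟶ c} (hφ : Inert φ)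
    (hψ : Inert ψ) : Inert (φ ≫ ψ) := by
  intro k hk
  obtain ⟨j, hj, hj'⟩ := hψ k hk
  have hj₀ : j ≠ 0 := by
    rintro rfl
    exact hk (hj.symm.trans ψ.2)
  obtain ⟨i, hi, hi'⟩ := hφ j hj₀
  exact ⟨i, (congrArg ψ.1 hi).trans hj, fun i₁ h₁ => hi' i₁ (hj' _ h₁)⟩

theorem FinPtd.Active.comp {a b c : FinPtd} {φ : a ⟶ b} {ψ : b ⟶ c} (hφ : Active φ)
    (hψ : Active ψ) : Active (φ ≫ ψ) :=
  fun i hi => hφ i (hψ _ hi)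

/-- An inert map `p` collapsing exactly the fibre of `φ` over the basepoint, together with a
section of `p`. -/
theorem FinPtd.exists_inert_section {a b : FinPtd} (φ : a ⟶ b) :
    ∃ (c : FinPtd) (p : a ⟶ c) (s : c ⟶ a), s ≫ p = 𝟙 c ∧
      (∀ i, φ.1 i = 0 → p.1 i = 0) ∧ (∀ i, φ.1 i ≠ 0 → s.1 (p.1 i) = i) ∧
      ∀ t, φ.1 (s.1 t) = 0 → t = 0 := by
  classical
  let e := Fintype.equivFin {i // φ.1 i ≠ 0}
  let p (i : Fin (a.n + 1)) : Fin (Fintype.card {i // φ.1 i ≠ 0} + 1) :=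
    if h : φ.1 i ≠ 0 then (e ⟨i, h⟩).succ else 0
  let s : Fin (Fintype.card {i // φ.1 i ≠ 0} + 1) → Fin (a.n + 1) :=
    Fin.cases 0 fun t => (e.symm t).1
  have hp {i} (h : φ.1 i = 0) : p i = 0 := dif_neg (not_not.mpr h)
  have hp' {i} (h : φ.1 i ≠ 0) : p i = (e ⟨i, h⟩).succ := dif_pos h
  refine ⟨⟨_⟩, ⟨p, hp φ.2⟩, ⟨s, rfl⟩, Subtype.ext (funext fun t => ?_), fun i => hp,
    fun i h => ?_, fun t h => ?_⟩
  · change p (s t) = t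
    induction t using Fin.cases with
    | zero => exact hp φ.2
    | succ t => exact (hp' (e.symm t).2).trans (congrArg Fin.succ (e.apply_symm_apply t))
  · change s (p i) = i
    rw [hp' h]
    simp [s]
  · induction t using Fin.cases with
    | zero => rfl
    | succ t => exact absurd h (e.symm t).2

theorem IsOFS.exists_fam_factor {L R : MorphismProperty C} (h : IsOFS L R)
    {A B : FamObj C} (F : A ⟶ B) :
    ∃ (Z : FamObj C) (l : A ⟶ Z) (r : Z ⟶ B), famLeft L l ∧ famRight R r ∧ l ≫ r = F := by
  obtain ⟨⟨n⟩, p, s, hsp, hp, hs, ht⟩ := FinPtd.exists_inert_section (FamHom.φ F)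
  choose z l r hl hr hlr hz using fun i => h.exists_option_factor (FamHom.f F i)
  have hz' (i) : z i = none ↔ (FamHom.φ F).1 i = 0 := (hz i).trans B.obj_eq_none_iff
  have hsp' (t) : p.1 (s.1 t) = t := congrArg (fun q => q.1 t) hsp
  let Z : FamObj C :=
    { len := n
      obj := fun t => z (s.1 t)
      obj_zero := (hz' _).mpr ((congrArg _ s.2).trans (FamHom.φ F).2)
      obj_ne := fun t h₀ => Option.isSome_iff_ne_none.mpr fun e => h₀ (ht t ((hz' _).mp e)) }
  have key (i) : ∃ l' : OHom (A.obj i) (z (s.1 (p.1 i))), OProp L l' ∧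
      HEq (OComp l' (r (s.1 (p.1 i)))) (FamHom.f F i) := by
    by_cases hi : (FamHom.φ F).1 i = 0
    · have hi' : (FamHom.φ F).1 (s.1 (p.1 i)) = 0 := by
        rw [hp i hi, s.2]
        exact (FamHom.φ F).2
      obtain ⟨l'⟩ := OHom.nonempty_of_none (x := A.obj i) ((hz' _).mpr hi')
      exact ⟨l', OProp_of_none L ((hz' _).mpr hi') _,
        OHom.heq_of_none (B.obj_eq_none_iff.mpr hi') (B.obj_eq_none_iff.mpr hi) _ _⟩
    · rw [hs i hi]
      exact ⟨l i, hl i, heq_of_eq (hlr i)⟩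
  choose l' hl' hlr' using key
  have hφ (i) : (FamHom.φ F).1 (s.1 (p.1 i)) = (FamHom.φ F).1 i := by
    by_cases hi : (FamHom.φ F).1 i = 0
    · rw [hp i hi, s.2, hi]
      exact (FamHom.φ F).2
    · rw [hs i hi]
  refine ⟨Z, ⟨p, l'⟩, ⟨s ≫ FamHom.φ F, fun t => r (s.1 t)⟩, ⟨fun t h₀ => ?_, hl'⟩,
    ⟨ht, fun t => hr _⟩, FamHom.ext' (Subtype.ext (funext hφ)) hlr'⟩
  refine ⟨s.1 t, hsp' t, fun i hi => ?_⟩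
  rw [← hi]
  refine (hs i fun h₁ => h₀ ?_).symm
  rw [← hi]
  exact hp i h₁

theorem FinPtd.Inert.exists_lift {a b x y : FinPtd} {l : a ⟶ b} {r : x ⟶ y} {u : a ⟶ x}
    {v : b ⟶ y} (hl : Inert l) (hr : Active r) (e : l ≫ v = u ≫ r) :
    ∃ d : b ⟶ x, l ≫ d = u ∧ d ≫ r = v := by
  classical
  have e' (i) : v.1 (l.1 i) = r.1 (u.1 i) := congrArg (fun q => q.1 i) e
  have hu (i) (hi : l.1 i = 0) : u.1 i = 0 :=
    hr _ ((e' i).symm.trans ((congrArg v.1 hi).trans v.2))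
  choose g hg hg' using hl
  let d (j : Fin (b.n + 1)) : Fin (x.n + 1) := if hj : j ≠ 0 then u.1 (g j hj) else 0
  have hd : d 0 = 0 := dif_neg (not_not.mpr rfl)
  have hd' {j} (hj : j ≠ 0) : d j = u.1 (g j hj) := dif_pos hj
  refine ⟨⟨d, hd⟩, Subtype.ext (funext fun i => ?_), Subtype.ext (funext fun j => ?_)⟩
  · change d (l.1 i) = u.1 i
    by_cases hi : l.1 i = 0
    · rw [hi, hd, hu i hi]
    · rw [hd' hi, ← hg' _ hi i rfl]
  · change r.1 (d j) = v.1 j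
    by_cases hj : j = 0
    · rw [hj, hd, r.2, v.2]
    · rw [hd' hj, ← e', hg]

theorem IsOFS.existsUnique_fam_lift {L R : MorphismProperty C} (h : IsOFS L R)
    {A B X Y : FamObj C} (l : A ⟶ B) (r : X ⟶ Y) (u : A ⟶ X) (v : B ⟶ Y)
    (hl : famLeft L l) (hr : famRight R r) (e : l ≫ v = u ≫ r) :
    ∃! d : B ⟶ X, l ≫ d = u ∧ d ≫ r = v := by
  obtain ⟨hl, hlL⟩ := hl
  obtain ⟨hr, hrR⟩ := hr
  obtain ⟨d, hld, hdr⟩ := hl.exists_lift hr (congrArg FamHom.φ e)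
  have hld' (i) : d.1 ((FamHom.φ l).1 i) = (FamHom.φ u).1 i := congrArg (fun q => q.1 i) hld
  have hdr' (j) : (FamHom.φ r).1 (d.1 j) = (FamHom.φ v).1 j := congrArg (fun q => q.1 j) hdr
  have lift {i j} (hj : (FamHom.φ l).1 i = j) {k} (hk : (FamHom.φ u).1 i = k)
      {m} (hm : (FamHom.φ r).1 k = m) (hv : (FamHom.φ v).1 j = m) :
      ∃! f : OHom (B.obj j) (X.obj k), OComp (FamHom.component l hj) f = FamHom.component u hk ∧
        OComp f (FamHom.component r hm) = FamHom.component v hv := by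
    have h₁ : (FamHom.φ (l ≫ v)).1 i = m := (congrArg _ hj).trans hv
    have h₂ : (FamHom.φ (u ≫ r)).1 i = m := (congrArg _ hk).trans hm
    refine h.existsUnique_option_lift _ _ _ _ (FamHom.oProp_component hlL hj)
      (FamHom.oProp_component hrR hm) (fun hY => ?_) ?_
    · rw [Y.obj_eq_none_iff] at hY
      exact X.obj_eq_none_iff.mpr (hr _ (hm.trans hY))
    · rw [← FamHom.component_comp l v hj hv h₁, ← FamHom.component_comp u r hk hm h₂]
      exact FamHom.component_congr e h₁ h₂
  have key (j) : ∃ f : OHom (B.obj j) (X.obj (d.1 j)),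
      (∀ i (hj : (FamHom.φ l).1 i = j) (hk : (FamHom.φ u).1 i = d.1 j),
        OComp (FamHom.component l hj) f = FamHom.component u hk) ∧
      OComp f (FamHom.f r (d.1 j)) = FamHom.component v (hdr' j).symm := by
    by_cases hj : j = 0
    · subst hj
      have hX : X.obj (d.1 0) = none := X.obj_eq_none_iff.mpr d.2
      have hY : Y.obj ((FamHom.φ r).1 (d.1 0)) = none :=
        Y.obj_eq_none_iff.mpr ((congrArg _ d.2).trans (FamHom.φ r).2)
      obtain ⟨f⟩ := OHom.nonempty_of_none (x := B.obj 0) hX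
      exact ⟨f, fun _ _ _ => OHom.eq_of_none hX _ _, OHom.eq_of_none hY _ _⟩
    · obtain ⟨i, hi, hi'⟩ := hl j hj
      have hk : (FamHom.φ u).1 i = d.1 j := by rw [← hld' i, hi]
      obtain ⟨f, ⟨h₁, h₂⟩, -⟩ := lift hi hk rfl (hdr' j).symm
      refine ⟨f, fun i₁ hj₁ hk₁ => ?_, h₂⟩
      obtain rfl := hi' i₁ hj₁
      exact h₁
  choose f hf₁ hf₂ using key
  let D : B ⟶ X := ⟨d, f⟩
  have hlD : l ≫ D = u := FamHom.ext_component hld' fun i k hk hk' => by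
    subst hk
    exact hf₁ _ i rfl hk'
  have hDr : D ≫ r = v := FamHom.ext_component hdr' fun j m hm hm' => by
    subst hm
    exact hf₂ j
  refine ⟨D, ⟨hlD, hDr⟩, fun D' ⟨hlD', hD'r⟩ => ?_⟩
  have hφ (j) : (FamHom.φ D').1 j = (FamHom.φ D).1 j := by
    by_cases hj : j = 0
    · rw [hj]
      exact (FamHom.φ D').2.trans d.2.symm
    · obtain ⟨i, rfl, -⟩ := hl j hj
      exact (congrArg (fun q : A ⟶ X => (FamHom.φ q).1 i) (hlD'.trans hlD.symm))
  refine FamHom.ext_component hφ fun j k hk hk' => ?_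
  by_cases hj : j = 0
  · subst hj
    exact OHom.eq_of_none (X.obj_eq_none_iff.mpr (hk'.symm.trans d.2)) _ _
  · obtain ⟨i, hi, -⟩ := hl j hj
    have hu : (FamHom.φ u).1 i = k := by rw [← hld' i, hi]; exact hk'
    have hv : (FamHom.φ v).1 j = (FamHom.φ r).1 k := by rw [← hdr' j]; exact congrArg _ hk'
    have sol {E : B ⟶ X} (hE : (FamHom.φ E).1 j = k) (hlE : l ≫ E = u) (hEr : E ≫ r = v) :
        OComp (FamHom.component l hi) (FamHom.component E hE) = FamHom.component u hu ∧
        OComp (FamHom.component E hE) (FamHom.component r rfl) = FamHom.component v hv := by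
      subst hlE hEr
      exact ⟨(FamHom.component_comp l E hi hE hu).symm,
        (FamHom.component_comp E r hE rfl hv).symm⟩
    exact (lift hi hu rfl hv).unique (sol hk hlD' hD'r) (sol hk' hlD hDr)

end FamLemmas

/-- If `(L, R)` is an orthogonal factorization system on `C`, then
`(L^⨿, R^⨿)` is an orthogonal factorization system on `C^⨿`. -/
theorem famOFS {C : Type u} [Category.{v} C] (L R : MorphismProperty C)
    (h : IsOFS L R) : IsOFS (famLeft L) (famRight R) where
  iso_left F _ := by
    refine ⟨fun j _ => ?_, Fam_iso_oProp h.iso_left F⟩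
    obtain ⟨i, hi⟩ := Fam_iso_φ_surjective F j
    exact ⟨i, hi, fun i' hi' => Fam_iso_φ_injective F (hi'.trans hi.symm)⟩
  iso_right F _ :=
    ⟨fun _ hi => Fam_iso_φ_injective F (hi.trans (FamHom.φ F).2.symm),
      Fam_iso_oProp h.iso_right F⟩
  comp_left _ _ hF hG :=
    ⟨hF.1.comp hG.1, fun i => OProp_comp h.comp_left _ _ (hF.2 i) (hG.2 _)⟩
  comp_right _ _ hF hG :=
    ⟨hF.1.comp hG.1, fun i => OProp_comp h.comp_right _ _ (hF.2 i) (hG.2 _)⟩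
  factor := h.exists_fam_factor
  lift_unique := h.existsUnique_fam_lift
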